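/- arXiv:1509.00863 — 2 statements merged into one kernel-verified Lean document; each statement's English description precedes it below -/
import Mathlib

section
/- Let a be strongly degenerate at x₀ ∈ (0,1). Then H¹_a(0,1) = X, where X is the set of u ∈ L²(0,1) that are locally absolutely continuous on [0,1] ∖ {x₀}, with √a·u' ∈ L²(0,1), such that the product a·u extends continuously to x₀ with value 0, i.e. lim_{x→x₀} a(x)u(x) = 0. In particular, every u ∈ H¹_a(0,1) satisfies lim_{x→x₀} a(x)u(x) = 0. -/
open MeasureTheory Set Filter

noncomputable section

/-- Absolute continuity of `u` on `[c,d]`, encoded via the fundamental theorem of calculus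
with an integrable derivative. -/
def ACOn (u : ℝ → ℝ) (c d : ℝ) : Prop :=
  IntervalIntegrable (deriv u) volume c d ∧
    ∀ x ∈ Icc c d, u x = u c + ∫ t in c..x, deriv u t

/-- Membership in `H¹(0,1)`. -/
def MemH1 (u : ℝ → ℝ) : Prop :=
  ACOn u 0 1 ∧ IntegrableOn (fun x => (u x)^2) (Ioo 0 1) ∧
    IntegrableOn (fun x => (deriv u x)^2) (Ioo 0 1)

/-- `a ∈ W^{1,1}(0,1)`. -/
def W11 (a : ℝ → ℝ) : Prop := ACOn a 0 1

/-- `a ∈ W^{1,∞}(0,1)`. -/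
def W1infty (a : ℝ → ℝ) : Prop :=
  ACOn a 0 1 ∧ ∃ M : ℝ, ∀ᵐ x ∂(volume.restrict (Icc (0:ℝ) 1)), |deriv a x| ≤ M

/-- Common part of the degeneracy conditions at `x₀` with constant `K`. -/
def DegAt (a : ℝ → ℝ) (x₀ K : ℝ) : Prop :=
  x₀ ∈ Ioo (0:ℝ) 1 ∧ a x₀ = 0 ∧ (∀ x ∈ Icc (0:ℝ) 1, x ≠ x₀ → 0 < a x) ∧
    ∀ᵐ x ∂(volume.restrict (Icc (0:ℝ) 1)), (x - x₀) * deriv a x ≤ K * a x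

/-- `a` is weakly degenerate at `x₀` with constant `K`. -/
def WeaklyDeg (a : ℝ → ℝ) (x₀ K : ℝ) : Prop :=
  DegAt a x₀ K ∧ W11 a ∧ K ∈ Ioo (0:ℝ) 1

/-- `a` is strongly degenerate at `x₀` with constant `K`. -/
def StronglyDeg (a : ℝ → ℝ) (x₀ K : ℝ) : Prop :=
  DegAt a x₀ K ∧ W1infty a ∧ K ∈ Ico (1:ℝ) 2

/-- Weakly (`wk = true`) or strongly (`wk = false`) degenerate. -/
def Deg (a : ℝ → ℝ) (x₀ K : ℝ) (wk : Bool) : Prop :=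
  cond wk (WeaklyDeg a x₀ K) (StronglyDeg a x₀ K)

/-- `H¹_a(0,1)` in the weakly degenerate case: absolutely continuous on `[0,1]`
with `√a · u' ∈ L²(0,1)`. -/
def MemH1aWeak (a u : ℝ → ℝ) : Prop :=
  ACOn u 0 1 ∧ IntegrableOn (fun x => a x * (deriv u x)^2) (Ioo 0 1)

/-- Locally absolutely continuous on `[0,x₀) ∪ (x₀,1]`. -/
def LocACAway (u : ℝ → ℝ) (x₀ : ℝ) : Prop :=
  (∀ c d : ℝ, 0 ≤ c → c ≤ d → d < x₀ → ACOn u c d) ∧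
  (∀ c d : ℝ, x₀ < c → c ≤ d → d ≤ 1 → ACOn u c d)

/-- `H¹_a(0,1)` in the strongly degenerate case. -/
def MemH1aStrong (a u : ℝ → ℝ) (x₀ : ℝ) : Prop :=
  IntegrableOn (fun x => (u x)^2) (Ioo 0 1) ∧ LocACAway u x₀ ∧
    IntegrableOn (fun x => a x * (deriv u x)^2) (Ioo 0 1)

/-- `H¹_a(0,1)`, weak (`wk = true`) or strong (`wk = false`) version. -/
def MemH1a (a u : ℝ → ℝ) (x₀ : ℝ) (wk : Bool) : Prop :=
  cond wk (MemH1aWeak a u) (MemH1aStrong a u x₀)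

/-- `H²_a(0,1) = {u ∈ H¹_a(0,1) : a u' ∈ H¹(0,1)}`. -/
def MemH2a (a u : ℝ → ℝ) (x₀ : ℝ) (wk : Bool) : Prop :=
  MemH1a a u x₀ wk ∧ ACOn (fun x => a x * deriv u x) 0 1 ∧
    IntegrableOn (fun x => (deriv (fun y => a y * deriv u y) x)^2) (Ioo 0 1)

/-- `D(A₁) = {u ∈ H²_a(0,1) : u'(0) = u'(1) = 0}`. -/
def MemDA1 (a u : ℝ → ℝ) (x₀ : ℝ) (wk : Bool) : Prop :=
  MemH2a a u x₀ wk ∧ deriv u 0 = 0 ∧ deriv u 1 = 0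

/-- `L²_{1/a}(0,1)`. -/
def MemL2inva (a u : ℝ → ℝ) : Prop :=
  IntegrableOn (fun x => (u x)^2) (Ioo 0 1) ∧
    IntegrableOn (fun x => (u x)^2 / a x) (Ioo 0 1)

/-- `H¹_{1/a}(0,1) = L²_{1/a}(0,1) ∩ H¹(0,1)`. -/
def MemH1inva (a u : ℝ → ℝ) : Prop :=
  MemL2inva a u ∧ ACOn u 0 1 ∧ IntegrableOn (fun x => (deriv u x)^2) (Ioo 0 1)

/-- `H²_{1/a}(0,1) = {u ∈ H¹_{1/a}(0,1) : u' ∈ H¹(0,1)}` (then `a u'' ∈ L²_{1/a}`). -/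
def MemH2inva (a u : ℝ → ℝ) : Prop :=
  MemH1inva a u ∧ ACOn (deriv u) 0 1 ∧
    IntegrableOn (fun x => a x * (deriv (deriv u) x)^2) (Ioo 0 1)

/-- `D(A₂) = {u ∈ H²_{1/a}(0,1) : u'(0) = u'(1) = 0}`. -/
def MemDA2 (a u : ℝ → ℝ) : Prop :=
  MemH2inva a u ∧ deriv u 0 = 0 ∧ deriv u 1 = 0

/-- The time weight `Θ(t) = 1/(t(T-t))⁴`. -/
def Theta (T t : ℝ) : ℝ := 1 / (t * (T - t))^4

/-- The space weight `ψ(x) = c₁ (∫_{x₀}^x (y-x₀)/a(y) dy − c₂)`. -/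
def psiW (a : ℝ → ℝ) (x₀ c₁ c₂ x : ℝ) : ℝ :=
  c₁ * ((∫ y in x₀..x, (y - x₀) / a y) - c₂)

/-- The weight `φ(t,x) = Θ(t) ψ(x)`. -/
def phiW (a : ℝ → ℝ) (x₀ c₁ c₂ T t x : ℝ) : ℝ := Theta T t * psiW a x₀ c₁ c₂ x

/-- The space weight `μ(x) = d₁ (∫_{x₀}^x (y-x₀)e^{R(y-x₀)²}/a(y) dy − d₂)`. -/
def muW (a : ℝ → ℝ) (x₀ d₁ d₂ R x : ℝ) : ℝ :=
  d₁ * ((∫ y in x₀..x, (y - x₀) * Real.exp (R * (y - x₀)^2) / a y) - d₂)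

/-- The weight `γ(t,x) = Θ(t) μ(x)`. -/
def gammaW (a : ℝ → ℝ) (x₀ d₁ d₂ R T t x : ℝ) : ℝ := Theta T t * muW a x₀ d₁ d₂ R x

/-- Hypotheses (A) of the divergence-form Carleman estimate. -/
def HypA (a : ℝ → ℝ) (x₀ K : ℝ) (wk : Bool) : Prop :=
  cond wk
    (WeaklyDeg a x₀ K ∧ ContDiffOn ℝ 1 a (Icc 0 1 \ {x₀}))
    (StronglyDeg a x₀ K ∧
      (4/3 < K → ∃ ϑ, ϑ ∈ Ioc (0:ℝ) K ∧
        AntitoneOn (fun x => a x / |x - x₀| ^ ϑ) (Ico 0 x₀) ∧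
        MonotoneOn (fun x => a x / |x - x₀| ^ ϑ) (Ioc x₀ 1) ∧
        (3/2 < K →
          (∃ ε > 0, ∀ x ∈ Icc (0:ℝ) 1, x ≠ x₀ → ε ≤ a x / |x - x₀| ^ ϑ) ∧
          ∃ S > 0, ∀ᵐ x ∂(volume.restrict (Icc (0:ℝ) 1)),
            |deriv a x| ≤ S * |x - x₀| ^ (2*ϑ - 3))))

/-- Hypotheses (B) of the non-divergence-form Carleman estimate. -/
def HypB (a : ℝ → ℝ) (x₀ K : ℝ) (wk : Bool) : Prop :=
  Deg a x₀ K wk ∧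
  (∃ L : NNReal, LipschitzOnWith L (fun x => (x - x₀) * deriv a x / a x) (Icc 0 1)) ∧
  (1/2 ≤ K → ∃ ϑ, ϑ ∈ Ioc (0:ℝ) K ∧
      AntitoneOn (fun x => a x / |x - x₀| ^ ϑ) (Ico 0 x₀) ∧
      MonotoneOn (fun x => a x / |x - x₀| ^ ϑ) (Ioc x₀ 1))

/-- `g ∈ L^∞_loc([0,1] ∖ {x₀})`. -/
def LocBddAway (g : ℝ → ℝ) (x₀ : ℝ) : Prop :=
  ∀ c d : ℝ, Icc c d ⊆ Icc (0:ℝ) 1 \ {x₀} →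
    ∃ M : ℝ, ∀ x ∈ Icc c d, |g x| ≤ M

/-- `h ∈ W^{1,∞}_loc([0,1] ∖ {x₀}; L^∞(0,1))`. -/
def LocW1inftyAway (h : ℝ → ℝ → ℝ) (x₀ : ℝ) : Prop :=
  ∀ c d : ℝ, Icc c d ⊆ Icc (0:ℝ) 1 \ {x₀} →
    (∃ M : ℝ, ∀ x ∈ Icc c d, ∀ B ∈ Icc (0:ℝ) 1, |h x B| ≤ M) ∧
    ∃ L : NNReal, ∀ B ∈ Icc (0:ℝ) 1, LipschitzOnWith L (fun x => h x B) (Icc c d)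

/-- Hypothesis (O) (with `σ = -1`) resp. (O') (with `σ = 1`):
`σ (a'/(2√a))(∫ₓᴮ g + h₀) + √a g = h(x,B)` for a.e. `x` and all admissible `B`. -/
def HypOgen (σ : ℝ) (a g : ℝ → ℝ) (h : ℝ → ℝ → ℝ) (g₀ h₀ x₀ : ℝ) : Prop :=
  0 < g₀ ∧ 0 < h₀ ∧
  (∀ᵐ x ∂(volume.restrict (Icc (0:ℝ) 1)), g₀ ≤ g x) ∧
  LocBddAway g x₀ ∧ LocW1inftyAway h x₀ ∧
  ∀ᵐ x ∂(volume.restrict (Icc (0:ℝ) 1)), ∀ B ∈ Icc (0:ℝ) 1,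
    ((x < B ∧ B < x₀) ∨ (x₀ < x ∧ x < B)) →
      σ * (deriv a x / (2 * Real.sqrt (a x))) * ((∫ t in x..B, g t) + h₀)
        + Real.sqrt (a x) * g x = h x B

/-- The space-time cylinder `Q_T = (0,T) × (0,1)`. -/
def QT (T : ℝ) : Set (ℝ × ℝ) := Ioo 0 T ×ˢ Ioo (0:ℝ) 1

/-- The class `𝒱 = L²(0,T; D(A₁)) ∩ H¹(0,T; H¹_a(0,1))`. -/
def InClassV (a : ℝ → ℝ) (x₀ T : ℝ) (wk : Bool) (v : ℝ → ℝ → ℝ) : Prop :=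
  (∀ t ∈ Ioo (0:ℝ) T, MemDA1 a (v t) x₀ wk) ∧
  IntegrableOn (fun p : ℝ × ℝ =>
    (v p.1 p.2)^2 + a p.2 * (deriv (v p.1) p.2)^2
      + (deriv (fun y => a y * deriv (v p.1) y) p.2)^2) (QT T) ∧
  IntegrableOn (fun p : ℝ × ℝ =>
    (deriv (fun τ => v τ p.2) p.1)^2
      + a p.2 * (deriv (fun y => deriv (fun τ => v τ y) p.1) p.2)^2) (QT T)

/-- The class `𝒮 = H¹(0,T; H¹_{1/a}(0,1)) ∩ L²(0,T; H²_{1/a}(0,1))`. -/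
def InClassS (a : ℝ → ℝ) (T : ℝ) (v : ℝ → ℝ → ℝ) : Prop :=
  (∀ t ∈ Ioo (0:ℝ) T, MemH2inva a (v t)) ∧
  IntegrableOn (fun p : ℝ × ℝ =>
    (v p.1 p.2)^2 / a p.2 + (deriv (v p.1) p.2)^2
      + a p.2 * (deriv (deriv (v p.1)) p.2)^2) (QT T) ∧
  IntegrableOn (fun p : ℝ × ℝ =>
    (deriv (fun τ => v τ p.2) p.1)^2 / a p.2
      + (deriv (fun y => deriv (fun τ => v τ y) p.1) p.2)^2) (QT T)

/-- Neumann boundary conditions `v_x(t,0) = v_x(t,1) = 0` for `t ∈ (0,T)`. -/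
def NeumannBC (T : ℝ) (v : ℝ → ℝ → ℝ) : Prop :=
  ∀ t ∈ Ioo (0:ℝ) T, deriv (v t) 0 = 0 ∧ deriv (v t) 1 = 0

/-- The equation `v_t + (a v_x)_x = h` in `Q_T`. -/
def SolDiv (a : ℝ → ℝ) (T : ℝ) (v h : ℝ → ℝ → ℝ) : Prop :=
  ∀ t ∈ Ioo (0:ℝ) T, ∀ x ∈ Ioo (0:ℝ) 1,
    deriv (fun τ => v τ x) t + deriv (fun y => a y * deriv (v t) y) x = h t x

/-- The equation `v_t + a v_xx = h` in `Q_T`. -/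
def SolNonDiv (a : ℝ → ℝ) (T : ℝ) (v h : ℝ → ℝ → ℝ) : Prop :=
  ∀ t ∈ Ioo (0:ℝ) T, ∀ x ∈ Ioo (0:ℝ) 1,
    deriv (fun τ => v τ x) t + a x * deriv (deriv (v t)) x = h t x

/-- Test function class `H¹(0,T; L²(0,1)) ∩ L²(0,T; H¹_a(0,1))` for the weak formulation
in divergence form. -/
def TestClassDiv (a : ℝ → ℝ) (x₀ T : ℝ) (wk : Bool) (φ : ℝ → ℝ → ℝ) : Prop :=
  (∀ t ∈ Icc (0:ℝ) T, MemH1a a (φ t) x₀ wk) ∧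
  IntegrableOn (fun p : ℝ × ℝ =>
    (φ p.1 p.2)^2 + a p.2 * (deriv (φ p.1) p.2)^2
      + (deriv (fun τ => φ τ p.2) p.1)^2) (QT T)

/-- Weak solution of `v_t + (a v_x)_x = 0` with Neumann boundary conditions. -/
def WeakSolDiv (a : ℝ → ℝ) (x₀ T : ℝ) (wk : Bool) (v : ℝ → ℝ → ℝ) : Prop :=
  (∀ t ∈ Icc (0:ℝ) T, MemH1a a (v t) x₀ wk) ∧
  IntegrableOn (fun p : ℝ × ℝ =>
    (v p.1 p.2)^2 + a p.2 * (deriv (v p.1) p.2)^2) (QT T) ∧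
  ∀ φ : ℝ → ℝ → ℝ, TestClassDiv a x₀ T wk φ →
    (∫ x in Ioo (0:ℝ) 1, v T x * φ T x) - (∫ x in Ioo (0:ℝ) 1, v 0 x * φ 0 x)
      - (∫ t in Ioo (0:ℝ) T, ∫ x in Ioo (0:ℝ) 1, v t x * deriv (fun τ => φ τ x) t)
      = ∫ t in Ioo (0:ℝ) T, ∫ x in Ioo (0:ℝ) 1, a x * deriv (v t) x * deriv (φ t) x

/-- Test function class `H¹(0,T; L²_{1/a}(0,1)) ∩ L²(0,T; H¹_{1/a}(0,1))` for the weak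
formulation in non-divergence form. -/
def TestClassNonDiv (a : ℝ → ℝ) (T : ℝ) (φ : ℝ → ℝ → ℝ) : Prop :=
  (∀ t ∈ Icc (0:ℝ) T, MemH1inva a (φ t)) ∧
  IntegrableOn (fun p : ℝ × ℝ =>
    (φ p.1 p.2)^2 / a p.2 + (deriv (φ p.1) p.2)^2
      + (deriv (fun τ => φ τ p.2) p.1)^2 / a p.2) (QT T)

/-- Weak solution of `v_t + a v_xx = 0` with Neumann boundary conditions. -/
def WeakSolNonDiv (a : ℝ → ℝ) (T : ℝ) (v : ℝ → ℝ → ℝ) : Prop :=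
  (∀ t ∈ Icc (0:ℝ) T, MemH1inva a (v t)) ∧
  IntegrableOn (fun p : ℝ × ℝ =>
    (v p.1 p.2)^2 / a p.2 + (deriv (v p.1) p.2)^2) (QT T) ∧
  ∀ φ : ℝ → ℝ → ℝ, TestClassNonDiv a T φ →
    (∫ x in Ioo (0:ℝ) 1, v T x * φ T x / a x) - (∫ x in Ioo (0:ℝ) 1, v 0 x * φ 0 x / a x)
      - (∫ t in Ioo (0:ℝ) T, ∫ x in Ioo (0:ℝ) 1, v t x * deriv (fun τ => φ τ x) t / a x)
      = ∫ t in Ioo (0:ℝ) T, ∫ x in Ioo (0:ℝ) 1, deriv (v t) x * deriv (φ t) x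

end

lemma acOn_aux {u : ℝ → ℝ} {c d : ℝ} (hcd : c ≤ d) (h : ACOn u c d) :
    AbsolutelyContinuousOnInterval u c d := by
  have h1 := h.1.absolutelyContinuousOnInterval_intervalIntegral (c := c) (by simp)
  rw [absolutelyContinuousOnInterval_iff] at h1 ⊢
  intro ε hε
  obtain ⟨δ, hδ, hh⟩ := h1 ε hε
  refine ⟨δ, hδ, fun E hE hs => ?_⟩
  have := hh E hE hs
  refine lt_of_eq_of_lt (Finset.sum_congr rfl fun i hi => ?_) this
  have h2 := hE.1 i hi
  rw [uIcc_of_le hcd] at h2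
  rw [h.2 _ h2.1, h.2 _ h2.2, dist_add_left]

/-- Nonintegrability contradiction. -/
lemma core_aux {a u : ℝ → ℝ} {x₀ b c M : ℝ} (hb : b ≠ x₀) (hc : 0 < c)
    (hu : IntervalIntegrable u volume x₀ b)
    (ha : ∀ x ∈ uIoc x₀ b, |a x| ≤ M * |x - x₀|)
    (hau : ∀ x ∈ uIoc x₀ b, x ≠ x₀ → c ≤ |a x * u x|) : False := by
  have : IntervalIntegrable (fun x => (x - x₀)⁻¹) volume x₀ b := by
    refine (hu.const_mul (M / c)).mono_fun ?_ ?_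
    · exact (measurable_id.sub_const x₀).inv.aestronglyMeasurable
    · filter_upwards [ae_restrict_mem measurableSet_uIoc] with x hx
      by_cases hxx : x = x₀
      · simp only [hxx, sub_self, inv_zero, norm_zero]
        exact norm_nonneg _
      have hp : 0 < |x - x₀| := abs_pos.2 (sub_ne_zero.2 hxx)
      have h1 := ha x hx
      have h2 := hau x hx hxx
      rw [abs_mul] at h2
      have h3 : c ≤ M * |x - x₀| * |u x| :=
        h2.trans (mul_le_mul_of_nonneg_right h1 (abs_nonneg _))
      have hle : (|x - x₀|)⁻¹ ≤ M / c * |u x| := by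
        rw [inv_eq_one_div, div_mul_eq_mul_div, div_le_div_iff₀ hp hc]
        linarith
      rw [norm_inv, Real.norm_eq_abs]
      refine hle.trans ?_
      rw [Real.norm_eq_abs, abs_mul]
      exact mul_le_mul_of_nonneg_right (le_abs_self _) (abs_nonneg _)
  rw [intervalIntegrable_sub_inv_iff] at this
  rcases this with h | h
  · exact hb h.symm
  · exact h left_mem_uIcc

lemma pick_aux {x₀ e δ : ℝ} (he : e ≠ x₀) (hδ : 0 < δ) :
    ∃ b ∈ uIcc x₀ e, b ≠ x₀ ∧ |b - x₀| < δ := by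
  rcases lt_or_gt_of_ne he with h | h
  · refine ⟨max e (x₀ - δ / 2), ?_, ?_, ?_⟩
    · rw [uIcc_of_ge h.le]; exact ⟨le_max_left _ _, max_le h.le (by linarith)⟩
    · exact (max_lt h (by linarith)).ne
    · have h1 : max e (x₀ - δ / 2) < x₀ := max_lt h (by linarith)
      have h2 := le_max_right e (x₀ - δ / 2)
      rw [abs_lt]; constructor <;> linarith
  · refine ⟨min e (x₀ + δ / 2), ?_, ?_, ?_⟩
    · rw [uIcc_of_le h.le]; exact ⟨le_min h.le (by linarith), min_le_left _ _⟩
    · exact (lt_min h (by linarith)).ne'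
    · have h1 : x₀ < min e (x₀ + δ / 2) := lt_min h (by linarith)
      have h2 := min_le_right e (x₀ + δ / 2)
      rw [abs_lt]; constructor <;> linarith

/-- One-sided limit. -/
lemma side_aux {a u g : ℝ → ℝ} {x₀ e M : ℝ} (he : e ≠ x₀)
    (hu : IntervalIntegrable u volume x₀ e) (hg : IntervalIntegrable g volume x₀ e)
    (ha : ∀ x ∈ uIcc x₀ e, |a x| ≤ M * |x - x₀|)
    (hau : ∀ x ∈ uIcc x₀ e, x ≠ x₀ → a x * u x = a e * u e + ∫ t in e..x, g t) :
    Tendsto (fun x => a x * u x) (nhdsWithin x₀ (uIcc x₀ e \ {x₀})) (nhds 0) := by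
  set G : ℝ → ℝ := fun x => a e * u e + ∫ t in e..x, g t with hG
  have hGc : ContinuousOn G (uIcc x₀ e) :=
    continuousOn_const.add
      (intervalIntegral.continuousOn_primitive_interval' hg right_mem_uIcc)
  have hGx : Tendsto G (nhdsWithin x₀ (uIcc x₀ e)) (nhds (G x₀)) := hGc x₀ left_mem_uIcc
  have hL : G x₀ = 0 := by
    by_contra hne
    have hpos : 0 < |G x₀| := abs_pos.2 hne
    have hev := hGx.abs.eventually (lt_mem_nhds (half_lt_self hpos))
    rw [Metric.nhdsWithin_basis_ball.eventually_iff] at hev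
    obtain ⟨δ, hδ, hh⟩ := hev
    obtain ⟨b, hb, hbne, hbδ⟩ := pick_aux he hδ
    have hsub : uIcc x₀ b ⊆ uIcc x₀ e := uIcc_subset_uIcc left_mem_uIcc hb
    refine core_aux (a := a) (u := u) (M := M) hbne (half_pos hpos)
      (hu.mono_set hsub) (fun x hx => ha x (hsub (uIoc_subset_uIcc hx))) (fun x hx hxx => ?_)
    have hx' := uIoc_subset_uIcc hx
    rw [hau x (hsub hx') hxx]
    refine (hh ⟨?_, hsub hx'⟩).le
    rw [Metric.mem_ball, Real.dist_eq]
    exact (abs_sub_left_of_mem_uIcc hx').trans_lt hbδ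
  rw [hL] at hGx
  refine (hGx.mono_left (nhdsWithin_mono _ sdiff_subset)).congr' ?_
  filter_upwards [self_mem_nhdsWithin] with x hx
  exact (hau x hx.1 hx.2).symm

lemma main_aux {a u : ℝ → ℝ} {x₀ K : ℝ} (ha : StronglyDeg a x₀ K)
    (h : MemH1aStrong a u x₀) :
    Tendsto (fun x => a x * u x) (nhdsWithin x₀ (Icc (0:ℝ) 1 \ {x₀})) (nhds 0) := by
  obtain ⟨⟨hx0, hax0, hapos, -⟩, ⟨haAC, M, hM⟩, -⟩ := ha
  obtain ⟨hu2, ⟨huL, huR⟩, hau2⟩ := h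
  have hA := acOn_aux zero_le_one haAC
  have hAc : ContinuousOn a (Icc 0 1) := by
    have := hA.continuousOn
    rwa [uIcc_of_le zero_le_one] at this
  have hM' : ∀ᵐ x, x ∈ Icc (0:ℝ) 1 → |deriv a x| ≤ M :=
    (ae_restrict_iff' measurableSet_Icc).1 hM
  have h01 : ∀ {x y : ℝ}, x ∈ Icc (0:ℝ) 1 → y ∈ Icc (0:ℝ) 1 → uIcc x y ⊆ Icc (0:ℝ) 1 := by
    intro x y hx hy
    exact ordConnected_Icc.uIcc_subset hx hy
  have hx0' : x₀ ∈ Icc (0:ℝ) 1 := Ioo_subset_Icc_self hx0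
  have hAlip : ∀ x ∈ Icc (0:ℝ) 1, |a x| ≤ M * |x - x₀| := by
    intro x hx
    have hs : AbsolutelyContinuousOnInterval a x₀ x :=
      hA.mono (by rw [uIcc_of_le zero_le_one]; exact h01 hx0' hx)
    have h1 := hs.integral_deriv_eq_sub
    rw [hax0, sub_zero] at h1
    rw [← h1, ← Real.norm_eq_abs]
    refine intervalIntegral.norm_integral_le_of_norm_le_const_ae ?_
    filter_upwards [hM'] with t ht hts
    exact ht (h01 hx0' hx (uIoc_subset_uIcc hts))
  have hUL : ∀ x, 0 ≤ x → x < x₀ → AbsolutelyContinuousOnInterval u 0 x :=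
    fun x h0 h1 => acOn_aux h0 (huL 0 x le_rfl h0 h1)
  have hUR : ∀ x, x₀ < x → x ≤ 1 → AbsolutelyContinuousOnInterval u x 1 :=
    fun x h0 h1 => acOn_aux h1 (huR x 1 h0 h1 le_rfl)
  have huc : ContinuousOn u (Ioo 0 1 \ {x₀}) := by
    intro x hx
    refine ContinuousAt.continuousWithinAt ?_
    rcases lt_or_gt_of_ne hx.2 with hlt | hgt
    · obtain ⟨y, hy1, hy2⟩ := exists_between hlt
      have := (hUL y (hx.1.1.trans hy1).le hy2).continuousOn
      rw [uIcc_of_le (hx.1.1.trans hy1).le] at this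
      exact this.continuousAt (Icc_mem_nhds hx.1.1 hy1)
    · obtain ⟨y, hy1, hy2⟩ := exists_between hgt
      have := (hUR y hy1 (hy2.trans hx.1.2).le).continuousOn
      rw [uIcc_of_le (hy2.trans hx.1.2).le] at this
      exact this.continuousAt (Icc_mem_nhds hy2 hx.1.2)
  have hum : AEStronglyMeasurable u (volume.restrict (Ioo 0 1)) := by
    have h1 := huc.aestronglyMeasurable (μ := volume)
      (measurableSet_Ioo.diff (measurableSet_singleton x₀))
    have : (volume.restrict (Ioo (0:ℝ) 1 \ {x₀})) = volume.restrict (Ioo (0:ℝ) 1) :=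
      Measure.restrict_congr_set (sdiff_null_ae_eq_self (by simp))
    rwa [this] at h1
  have ham : AEStronglyMeasurable a (volume.restrict (Ioo 0 1)) :=
    (hAc.mono Ioo_subset_Icc_self).aestronglyMeasurable measurableSet_Ioo
  have hui : IntegrableOn u (Ioo 0 1) := by
    have hc : IntegrableOn (fun _ : ℝ => (1:ℝ)) (Ioo 0 1) := by simp
    refine Integrable.mono' (hc.add hu2) hum (Eventually.of_forall fun x => ?_)
    simp only [Pi.add_apply, Real.norm_eq_abs]
    nlinarith [sq_nonneg (|u x| - 1), sq_abs (u x), abs_nonneg (u x)]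
  have hai : IntegrableOn a (Ioo 0 1) :=
    (hAc.integrableOn_Icc).mono_set Ioo_subset_Icc_self
  have hg1 : IntegrableOn (fun x => deriv a x * u x) (Ioo 0 1) := by
    refine Integrable.bdd_mul (c := M) hui (measurable_deriv a).aestronglyMeasurable ?_
    exact ae_restrict_of_ae_restrict_of_subset Ioo_subset_Icc_self hM
  have hg2 : IntegrableOn (fun x => a x * deriv u x) (Ioo 0 1) := by
    refine Integrable.mono' (hai.add hau2)
      (ham.mul (measurable_deriv u).aestronglyMeasurable) ?_
    filter_upwards [ae_restrict_mem measurableSet_Ioo] with x hx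
    have hax : 0 ≤ a x := by
      by_cases hxx : x = x₀
      · rw [hxx, hax0]
      · exact (hapos x (Ioo_subset_Icc_self hx) hxx).le
    simp only [Pi.add_apply, Real.norm_eq_abs]
    rw [abs_mul, abs_of_nonneg hax]
    have : |deriv u x| ≤ 1 + deriv u x ^ 2 := by
      nlinarith [sq_nonneg (|deriv u x| - 1), sq_abs (deriv u x), abs_nonneg (deriv u x)]
    nlinarith [mul_le_mul_of_nonneg_left this hax]
  have hii : ∀ {f : ℝ → ℝ}, IntegrableOn f (Ioo 0 1) → ∀ {x y : ℝ}, x ∈ Icc (0:ℝ) 1 →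
      y ∈ Icc (0:ℝ) 1 → IntervalIntegrable f volume x y := by
    intro f hf x y hx hy
    have hf' : IntervalIntegrable f volume 0 1 :=
      (intervalIntegrable_iff_integrableOn_Ioo_of_le zero_le_one).2 hf
    exact hf'.mono_set (by rw [uIcc_of_le zero_le_one]; exact h01 hx hy)
  have hg := hg1.add hg2
  have m0 : (0:ℝ) ∈ Icc (0:ℝ) 1 := by simp
  have m1 : (1:ℝ) ∈ Icc (0:ℝ) 1 := by simp
  have sL := side_aux (a := a) (u := u) (M := M)
    (g := fun x => deriv a x * u x + a x * deriv u x) hx0.1.ne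
    (hii hui hx0' m0) (hii hg hx0' m0) (fun x hx => hAlip x (h01 hx0' m0 hx)) (by
      intro x hx hxx
      rw [uIcc_of_ge hx0.1.le] at hx
      have hlt := lt_of_le_of_ne hx.2 hxx
      have hs : AbsolutelyContinuousOnInterval a 0 x :=
        hA.mono (by rw [uIcc_of_le zero_le_one]; exact h01 m0 ⟨hx.1, hlt.le.trans hx0'.2⟩)
      rw [hs.integral_deriv_mul_eq_sub (hUL x hx.1 hlt)]
      ring)
  have sR := side_aux (a := a) (u := u) (M := M)
    (g := fun x => deriv a x * u x + a x * deriv u x) hx0.2.ne'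
    (hii hui hx0' m1) (hii hg hx0' m1) (fun x hx => hAlip x (h01 hx0' m1 hx)) (by
      intro x hx hxx
      rw [uIcc_of_le hx0.2.le] at hx
      have hlt := lt_of_le_of_ne hx.1 (Ne.symm hxx)
      have hs : AbsolutelyContinuousOnInterval a 1 x :=
        hA.mono (by rw [uIcc_of_le zero_le_one]; exact h01 m1 ⟨hx0'.1.trans hlt.le, hx.2⟩)
      rw [hs.integral_deriv_mul_eq_sub (hUR x hlt hx.2).symm]
      ring)
  have hun : Icc (0:ℝ) 1 \ {x₀} ⊆ (uIcc x₀ 0 \ {x₀}) ∪ (uIcc x₀ 1 \ {x₀}) := by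
    rw [uIcc_of_ge hx0.1.le, uIcc_of_le hx0.2.le]
    rintro x ⟨⟨h0, h1⟩, hn⟩
    rcases le_total x x₀ with hle | hle
    · exact Or.inl ⟨⟨h0, hle⟩, hn⟩
    · exact Or.inr ⟨⟨hle, h1⟩, hn⟩
  refine Tendsto.mono_left ?_ (nhdsWithin_mono _ hun)
  rw [nhdsWithin_union]
  exact sL.sup sR

/-- Characterization of `H¹_a(0,1)` in the strongly degenerate case. -/
theorem statement5 (a : ℝ → ℝ) (x₀ : ℝ) (ha : ∃ K, StronglyDeg a x₀ K) :
    ∀ u : ℝ → ℝ, MemH1aStrong a u x₀ ↔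
      (IntegrableOn (fun x => (u x)^2) (Ioo 0 1) ∧ LocACAway u x₀ ∧
        IntegrableOn (fun x => a x * (deriv u x)^2) (Ioo 0 1) ∧
        Filter.Tendsto (fun x => a x * u x)
          (nhdsWithin x₀ (Icc (0:ℝ) 1 \ {x₀})) (nhds 0)) := by
  intro u
  constructor
  · intro h
    obtain ⟨K, hK⟩ := ha
    exact ⟨h.1, h.2.1, h.2.2, main_aux hK h⟩
  · rintro ⟨h1, h2, h3, -⟩
    exact ⟨h1, h2, h3⟩
end

section
/- Let a be strongly degenerate at x₀ ∈ (0,1). Then D(A₁) = D, where D is the set of u ∈ L²(0,1) that are locally absolutely continuous on [0,1] ∖ {x₀} and satisfy: a·u ∈ H¹(0,1), a·u' ∈ H¹(0,1), a·u is continuous at x₀ with lim_{x→x₀} a(x)u(x) = 0, lim_{x→x₀} a(x)u'(x) = 0, and u'(0) = u'(1) = 0. -/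
open MeasureTheory Set Filter

open AbsolutelyContinuousOnInterval in
lemma aci_congr {f g : ℝ → ℝ} {c d : ℝ} (h : AbsolutelyContinuousOnInterval f c d)
    (hfg : ∀ x ∈ uIcc c d, g x = f x) : AbsolutelyContinuousOnInterval g c d := by
  rw [absolutelyContinuousOnInterval_iff] at *
  intro ε hε
  obtain ⟨δ, hδ, H⟩ := h ε hε
  refine ⟨δ, hδ, fun E hE hs => ?_⟩
  have := H E hE hs
  have e : ∑ i ∈ Finset.range E.1, dist (g (E.2 i).1) (g (E.2 i).2)
      = ∑ i ∈ Finset.range E.1, dist (f (E.2 i).1) (f (E.2 i).2) := by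
    refine Finset.sum_congr rfl fun i hi => ?_
    have h2 := (hE.1 i hi)
    rw [hfg _ h2.1, hfg _ h2.2]
  rw [e]; exact this

lemma ACOn.aci {f : ℝ → ℝ} {c d : ℝ} (hcd : c ≤ d) (h : ACOn f c d) :
    AbsolutelyContinuousOnInterval f c d := by
  have h1 := h.1.absolutelyContinuousOnInterval_intervalIntegral (c := c) (by simp)
  have h2 : AbsolutelyContinuousOnInterval (fun _ : ℝ => f c) c d :=
    (contDiff_const.contDiffOn).absolutelyContinuousOnInterval
  refine aci_congr (h2.add h1) fun x hx => ?_
  rw [uIcc_of_le hcd] at hx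
  exact h.2 x hx

lemma aci_eq {f : ℝ → ℝ} {c d x : ℝ} (h : AbsolutelyContinuousOnInterval f c d)
    (hx : x ∈ uIcc c d) : f x = f c + ∫ t in c..x, deriv f t := by
  have := (h.mono (uIcc_subset_uIcc (left_mem_uIcc) hx)).integral_deriv_eq_sub
  linarith

/-- the limit of `a u` at `x₀` vanishes if `u` is square integrable -/
lemma lim_zero {a u g : ℝ → ℝ} {e x₀ M : ℝ} (he : e ≠ x₀) (hd : |e - x₀| ≤ 1) (hM : 0 < M)
    (ham : ∀ x ∈ uIcc e x₀, |a x| ≤ M * |x - x₀|)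
    (hg : IntervalIntegrable g volume e x₀)
    (hu : IntervalIntegrable (fun x => (u x)^2) volume e x₀)
    (hv : ∀ x ∈ uIcc e x₀, x ≠ x₀ → a x * u x = a e * u e + ∫ t in e..x, g t) :
    a e * u e + ∫ t in e..x₀, g t = 0 := by
  by_contra hL
  set L := a e * u e + ∫ t in e..x₀, g t with hLdef
  have hc : ContinuousOn (fun x => a e * u e + ∫ t in e..x, g t) (uIcc e x₀) :=
    continuousOn_const.add (intervalIntegral.continuousOn_primitive_interval' hg left_mem_uIcc)
  have hLp : 0 < |L| := abs_pos.mpr hL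
  have h1 := Metric.continuousOn_iff.mp hc x₀ right_mem_uIcc (|L|/2) (by positivity)
  obtain ⟨δ, hδ, H⟩ := h1
  -- a point y between e and x₀, close to x₀
  obtain ⟨y, hy1, hy2, hy3⟩ : ∃ y ∈ uIcc e x₀, y ≠ x₀ ∧ |y - x₀| < δ := by
    set s := min (1/2) (δ / 2)
    have hs0 : 0 < s := by positivity
    have hs1 : s ≤ 1/2 := min_le_left _ _
    have hs2 : s ≤ δ/2 := min_le_right _ _
    refine ⟨x₀ + s * (e - x₀), ?_, ?_, ?_⟩
    · rcases lt_or_gt_of_ne he with h | h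
      · rw [uIcc_of_le h.le]; constructor <;> nlinarith
      · rw [uIcc_of_ge h.le]; constructor <;> nlinarith
    · have : s * (e - x₀) ≠ 0 := mul_ne_zero hs0.ne' (sub_ne_zero.mpr he)
      intro h; apply this; linarith
    · rw [add_sub_cancel_left, abs_mul, abs_of_pos hs0]
      nlinarith [abs_nonneg (e - x₀)]
  have hsub : uIcc y x₀ ⊆ uIcc e x₀ := uIcc_subset_uIcc hy1 right_mem_uIcc
  have hu' : IntervalIntegrable (fun x => (u x)^2) volume y x₀ := hu.mono_set hsub
  have key : IntervalIntegrable (fun x => (x - x₀)⁻¹) volume y x₀ := by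
    refine (hu'.const_mul ((2*M/|L|)^2)).mono_fun' ?_ ?_
    · exact (measurable_id.sub_const x₀).inv.aestronglyMeasurable
    · refine (ae_restrict_iff' measurableSet_uIoc).mpr (Eventually.of_forall fun x hx => ?_)
      have hx1 : x ∈ uIcc y x₀ := uIoc_subset_uIcc hx
      have hx2 := hsub hx1
      by_cases hxx : x = x₀
      · subst hxx; simp; positivity
      have hxd : |x - x₀| ≤ |y - x₀| := abs_sub_right_of_mem_uIcc hx1 |>.trans_eq (abs_sub_comm _ _) |> fun h => by
        rw [abs_sub_comm x x₀]; exact h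
      have hxe : |x - x₀| ≤ 1 := by
        have : |x₀ - x| ≤ |x₀ - e| := abs_sub_right_of_mem_uIcc hx2
        rw [abs_sub_comm x₀ x, abs_sub_comm x₀ e] at this
        linarith
      have h3 := H x hx2 (by rw [Real.dist_eq]; linarith)
      rw [Real.dist_eq, ← hv x hx2 hxx] at h3
      have h4 : |L|/2 ≤ |a x * u x| := by
        have := abs_sub_abs_le_abs_sub L (a x * u x)
        rw [abs_sub_comm] at this
        linarith
      have hp : 0 < |x - x₀| := abs_pos.mpr (sub_ne_zero.mpr hxx)
      have h5 : |L|/2 ≤ M * |x - x₀| * |u x| := by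
        rw [abs_mul] at h4
        exact h4.trans (mul_le_mul_of_nonneg_right (ham x hx2) (abs_nonneg _))
      have h6 : 1 ≤ (2*M/|L|) * |u x| * |x - x₀| := by
        have : (2*M/|L|) * |u x| * |x - x₀| = (M * |x - x₀| * |u x|) / (|L|/2) := by
          field_simp
        rw [this, le_div_iff₀ (by positivity)]; linarith
      change ‖(x - x₀)⁻¹‖ ≤ (2 * M / |L|) ^ 2 * u x ^ 2
      rw [norm_inv, Real.norm_eq_abs, ← sq_abs (u x)]
      have h7 : |x - x₀|⁻¹ ≤ (2*M/|L|) * |u x| := by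
        rw [inv_le_iff_one_le_mul₀ hp]; exact h6
      have h8 : 1 ≤ |x - x₀|⁻¹ := (one_le_inv₀ hp).mpr hxe
      nlinarith
  rw [intervalIntegrable_sub_inv_iff] at key
  rcases key with h | h
  · exact hy2 h
  · exact h right_mem_uIcc

lemma mono_quot {a : ℝ → ℝ} {c d x₀ K σ : ℝ} (hσ : σ * σ = 1) (hcd : c ≤ d)
    (ha : AbsolutelyContinuousOnInterval a c d)
    (hpos : ∀ x ∈ Icc c d, 0 < σ * (x - x₀))
    (hK : ∀ᵐ x, x ∈ Icc c d → (x - x₀) * deriv a x ≤ K * a x) :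
    σ * (a d * (σ * (d - x₀)) ^ (-K) - a c * (σ * (c - x₀)) ^ (-K)) ≤ 0 := by
  have hp : AbsolutelyContinuousOnInterval (fun x => (σ * (x - x₀)) ^ (-K)) c d := by
    apply ContDiffOn.absolutelyContinuousOnInterval
    rw [uIcc_of_le hcd]
    refine ContDiffOn.rpow_const_of_ne ?_ fun x hx => (hpos x hx).ne'
    fun_prop
  have h := ha.fun_mul hp
  rw [← h.integral_deriv_eq_sub, ← intervalIntegral.integral_const_mul]
  have hn : 0 ≤ ∫ x in c..d, -(σ * deriv (fun x => a x * (σ * (x - x₀)) ^ (-K)) x) := by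
    refine intervalIntegral.integral_nonneg_of_ae_restrict hcd ?_
    refine (ae_restrict_iff' measurableSet_Icc).mpr ?_
    filter_upwards [ha.ae_differentiableAt, hK] with x h1 h2 hx
    have h3 := (h1 (by rwa [uIcc_of_le hcd])).hasDerivAt
    have hx0 := hpos x hx
    have h4 : HasDerivAt (fun x => σ * (x - x₀)) σ x := by
      simpa using ((hasDerivAt_id x).sub_const x₀).const_mul σ
    have h5 := h3.mul (h4.rpow_const (p := -K) (Or.inl hx0.ne'))
    have h5' := h5.deriv
    simp only [Pi.zero_apply]
    change deriv (fun x => a x * (σ * (x - x₀)) ^ (-K)) x = _ at h5'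
    rw [h5']
    have h6 : (σ * (x - x₀)) ^ (-K) = (σ * (x - x₀)) ^ (-K - 1) * (σ * (x - x₀)) := by
      rw [Real.rpow_sub_one hx0.ne', div_mul_cancel₀ _ hx0.ne']
    rw [h6]
    have h7 : 0 < (σ * (x - x₀)) ^ (-K - 1) := Real.rpow_pos_of_pos hx0 _
    have h8 := h2 hx
    have : -(σ * (deriv a x * ((σ * (x - x₀)) ^ (-K - 1) * (σ * (x - x₀))) +
        a x * (σ * -K * (σ * (x - x₀)) ^ (-K - 1)))) =
        (σ * σ) * (σ * (x - x₀)) ^ (-K - 1) * (K * a x - (x - x₀) * deriv a x) := by ring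
    rw [this, hσ, one_mul]
    exact mul_nonneg h7.le (by linarith)
  rw [intervalIntegral.integral_neg] at hn
  linarith

lemma deg_lower {a : ℝ → ℝ} {x₀ K : ℝ} (h : DegAt a x₀ K)
    (ha : AbsolutelyContinuousOnInterval a 0 1) :
    ∃ c > 0, ∀ x ∈ Icc (0:ℝ) 1, x ≠ x₀ → c * |x - x₀| ^ K ≤ a x := by
  obtain ⟨⟨h0, h1⟩, hz, hp, hK⟩ := h
  have hK := (ae_restrict_iff' measurableSet_Icc).mp hK
  refine ⟨min (a 0 * x₀ ^ (-K)) (a 1 * (1 - x₀) ^ (-K)), ?_, ?_⟩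
  · have := hp 0 (by simp) h0.ne
    have := hp 1 (by simp) h1.ne'
    have : 0 < 1 - x₀ := by linarith
    positivity
  intro x hx hxx
  rcases lt_or_gt_of_ne hxx with hl | hl
  · have := mono_quot (a := a) (c := 0) (d := x) (x₀ := x₀) (K := K) (σ := -1) (by norm_num) hx.1
      (ha.mono (by rw [uIcc_of_le hx.1, uIcc_of_le zero_le_one]; exact Icc_subset_Icc_right hx.2))
      (fun y hy => by linarith [hy.2])
      (hK.mono fun y hy h => hy ⟨h.1, h.2.trans hx.2⟩)
    have hq : 0 < x₀ - x := by linarith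
    rw [abs_sub_comm, abs_of_pos hq]
    have e1 : (-1 * (x - x₀)) = x₀ - x := by ring
    have e2 : (-1 * (0 - x₀)) = x₀ := by ring
    rw [e1, e2, Real.rpow_neg hq.le K] at this
    have hqK := Real.rpow_pos_of_pos hq K
    calc _ ≤ a 0 * x₀ ^ (-K) * (x₀ - x) ^ K := by gcongr; exact min_le_left _ _
      _ ≤ (a x * ((x₀ - x) ^ K)⁻¹) * (x₀ - x) ^ K :=
        mul_le_mul_of_nonneg_right (by linarith) hqK.le
      _ = a x := by field_simp
  · have := mono_quot (a := a) (c := x) (d := 1) (x₀ := x₀) (K := K) (σ := 1) (by norm_num) hx.2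
      (ha.mono (by rw [uIcc_of_le hx.2, uIcc_of_le zero_le_one]; exact Icc_subset_Icc_left hx.1))
      (fun y hy => by linarith [hy.1])
      (hK.mono fun y hy h => hy ⟨hx.1.trans h.1, h.2⟩)
    have hq : 0 < x - x₀ := by linarith
    rw [abs_of_pos hq]
    rw [one_mul, one_mul, one_mul, Real.rpow_neg hq.le K] at this
    have hqK := Real.rpow_pos_of_pos hq K
    calc _ ≤ a 1 * (1 - x₀) ^ (-K) * (x - x₀) ^ K := by gcongr; exact min_le_right _ _
      _ ≤ (a x * ((x - x₀) ^ K)⁻¹) * (x - x₀) ^ K :=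
        mul_le_mul_of_nonneg_right (by linarith) hqK.le
      _ = a x := by field_simp

lemma integrable_abs_rpow {x₀ r : ℝ} (hr : -1 < r) :
    IntegrableOn (fun x => |x - x₀| ^ r) (Ioo 0 1) := by
  have h1 : IntervalIntegrable (fun x => (x - x₀) ^ r) volume 0 1 := by
    have := (intervalIntegral.intervalIntegrable_rpow' (a := 0 - x₀) (b := 1 - x₀) hr).comp_sub_right x₀
    simpa using this
  have h2 : IntervalIntegrable (fun x => (x₀ - x) ^ r) volume 0 1 := by
    have := (intervalIntegral.intervalIntegrable_rpow' (a := x₀ - 0) (b := x₀ - 1) hr).comp_sub_left x₀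
    simpa using this
  have h3 := h1.norm.add h2.norm
  rw [intervalIntegrable_iff_integrableOn_Ioo_of_le zero_le_one] at h3
  refine h3.mono' ?_ (Eventually.of_forall fun x => ?_)
  · exact (((measurable_id.sub_const x₀).abs).pow_const r).aestronglyMeasurable
  · rw [Real.norm_of_nonneg (by positivity)]
    rcases le_total 0 (x - x₀) with h | h
    · rw [abs_of_nonneg h]
      have k1 := norm_nonneg ((x₀ - x) ^ r)
      have k2 := Real.le_norm_self ((x - x₀) ^ r)
      linarith
    · rw [abs_of_nonpos h, neg_sub]
      have k1 := norm_nonneg ((x - x₀) ^ r)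
      have k2 := Real.le_norm_self ((x₀ - x) ^ r)
      linarith

lemma lip_bound {a : ℝ → ℝ} {x₀ : ℝ} (hx₀ : x₀ ∈ Ioo (0:ℝ) 1) (h0 : a x₀ = 0) (h : W1infty a) :
    ∃ M > 0, (∀ x ∈ Icc (0:ℝ) 1, |a x| ≤ M * |x - x₀|) ∧
      ∀ᵐ x, x ∈ Icc (0:ℝ) 1 → |deriv a x| ≤ M := by
  obtain ⟨h1, M, hM⟩ := h
  have ha := h1.aci zero_le_one
  have hM := (ae_restrict_iff' measurableSet_Icc).mp hM
  refine ⟨max M 1, by positivity, fun x hx => ?_,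
    hM.mono fun x h hx => (h hx).trans (le_max_left _ _)⟩
  have hI : uIcc x₀ x ⊆ Icc 0 1 := by
    rw [← uIcc_of_le (zero_le_one' ℝ)]
    exact uIcc_subset_uIcc (by rw [uIcc_of_le zero_le_one]; exact ⟨hx₀.1.le, hx₀.2.le⟩)
      (by rwa [uIcc_of_le zero_le_one])
  have e := (ha.mono (c := x₀) (d := x) (by rw [uIcc_of_le (zero_le_one' ℝ)]; exact hI)).integral_deriv_eq_sub
  rw [h0, sub_zero] at e
  rw [← e]
  rw [← Real.norm_eq_abs]
  refine intervalIntegral.norm_integral_le_of_norm_le_const_ae (hM.mono fun y hy hyy => ?_)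
  exact (hy (hI (uIoc_subset_uIcc hyy))).trans (le_max_left _ _)

lemma backward {a u : ℝ → ℝ} {x₀ K : ℝ} (hd : StronglyDeg a x₀ K)
    (hw : ACOn (fun x => a x * deriv u x) 0 1)
    (hw2 : IntegrableOn (fun x => (deriv (fun y => a y * deriv u y) x)^2) (Ioo 0 1)) :
    IntegrableOn (fun x => a x * (deriv u x)^2) (Ioo 0 1) := by
  obtain ⟨hdeg, hW, hK⟩ := hd
  have ha := hW.1.aci zero_le_one
  have hx₀ := hdeg.1
  have haz := hdeg.2.1
  obtain ⟨c, hc, hlow⟩ := deg_lower hdeg ha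
  have hwa := hw.aci zero_le_one
  set w : ℝ → ℝ := fun x => a x * deriv u x with hwdef
  set G := ∫ t in (0:ℝ)..1, (deriv w t)^2 with hG
  have hint : IntervalIntegrable (fun t => (deriv w t)^2) volume 0 1 := by
    rw [intervalIntegrable_iff_integrableOn_Ioo_of_le zero_le_one]; exact hw2
  have hG0 : 0 ≤ G := intervalIntegral.integral_nonneg zero_le_one fun _ _ => sq_nonneg _
  have hwb : ∀ x ∈ Icc (0:ℝ) 1, x ≠ x₀ → |w x| ≤ Real.sqrt |x - x₀| * (G + 1) := by
    intro x hx hxx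
    have hI : uIcc x₀ x ⊆ uIcc 0 1 :=
      uIcc_subset_uIcc (by rw [uIcc_of_le zero_le_one]; exact ⟨hx₀.1.le, hx₀.2.le⟩)
        (by rwa [uIcc_of_le zero_le_one])
    have e := (hwa.mono hI).integral_deriv_eq_sub
    have hw0 : w x₀ = 0 := by simp [hwdef, haz]
    rw [hw0, sub_zero] at e
    have hp : 0 < |x - x₀| := abs_pos.mpr (sub_ne_zero.mpr hxx)
    set s := Real.sqrt |x - x₀| with hs
    have hs0 : 0 < s := Real.sqrt_pos.mpr hp
    have hss : s * s = |x - x₀| := Real.mul_self_sqrt hp.le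
    have hi2 := hint.mono_set hI
    rw [← e, ← Real.norm_eq_abs]
    calc ‖∫ t in x₀..x, deriv w t‖
        ≤ |∫ t in x₀..x, (s * (deriv w t)^2 + s⁻¹)| := by
          refine intervalIntegral.norm_integral_le_abs_of_norm_le (Eventually.of_forall fun t => ?_)
            ((hi2.const_mul s).add intervalIntegrable_const)
          rw [Real.norm_eq_abs, ← sq_abs (deriv w t)]
          have : 0 ≤ s⁻¹ * ((s * |deriv w t| - 1)^2 + s * |deriv w t|) := by positivity
          have e2 : s⁻¹ * ((s * |deriv w t| - 1)^2 + s * |deriv w t|) =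
            s * |deriv w t|^2 + s⁻¹ - |deriv w t| := by field_simp; ring
          linarith
      _ = |s * (∫ t in x₀..x, (deriv w t)^2) + (x - x₀) * s⁻¹| := by
          rw [intervalIntegral.integral_add (hi2.const_mul s) intervalIntegrable_const,
            intervalIntegral.integral_const_mul, intervalIntegral.integral_const, smul_eq_mul]
      _ ≤ s * |∫ t in x₀..x, (deriv w t)^2| + |x - x₀| * s⁻¹ := by
          refine (abs_add_le _ _).trans_eq ?_
          rw [abs_mul, abs_mul, abs_of_pos hs0, abs_of_pos (inv_pos.mpr hs0)]
      _ ≤ s * G + |x - x₀| * s⁻¹ := by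
          gcongr
          have := intervalIntegral.abs_integral_mono_interval (f := fun t => (deriv w t)^2)
            (μ := volume) (a := x₀) (b := x) (c := 0) (d := 1)
            (uIoc_subset_uIoc_of_uIcc_subset_uIcc hI) (Eventually.of_forall fun t => sq_nonneg _) hint
          rwa [abs_of_nonneg hG0] at this
      _ = s * (G + 1) := by rw [← hss]; field_simp
  have hr : IntegrableOn (fun x => ((G+1)^2 / c) * |x - x₀| ^ (1 - K)) (Ioo 0 1) :=
    (integrable_abs_rpow (by linarith [hK.2])).const_mul _
  refine hr.mono' ?_ ?_
  · refine AEStronglyMeasurable.mul ?_ ((measurable_deriv u).pow_const 2).aestronglyMeasurable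
    have := ha.continuousOn
    rw [uIcc_of_le zero_le_one] at this
    exact (this.mono Ioo_subset_Icc_self).aestronglyMeasurable measurableSet_Ioo
  · refine (ae_restrict_iff' measurableSet_Ioo).mpr ?_
    have hne : ∀ᵐ x : ℝ, x ≠ x₀ := by simp [ae_iff, measure_singleton]
    filter_upwards [hne] with x hxx hx
    have hx' := Ioo_subset_Icc_self hx
    have hp : 0 < |x - x₀| := abs_pos.mpr (sub_ne_zero.mpr hxx)
    have hax : 0 < a x := hdeg.2.2.1 x hx' hxx
    have hb := hwb x hx' hxx
    have hl := hlow x hx' hxx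
    have hpK := Real.rpow_pos_of_pos hp K
    rw [Real.norm_of_nonneg (by positivity), Real.rpow_sub hp, Real.rpow_one]
    have e1 : a x * deriv u x ^ 2 = |w x|^2 / a x := by
      rw [sq_abs, hwdef]; field_simp
    rw [e1]
    calc |w x|^2 / a x ≤ (Real.sqrt |x - x₀| * (G + 1))^2 / (c * |x - x₀| ^ K) := by gcongr
      _ = _ := by rw [mul_pow, Real.sq_sqrt hp.le]; field_simp

lemma ae_diff_away {u : ℝ → ℝ} {x₀ : ℝ} (h : LocACAway u x₀) :
    ∀ᵐ x, x ∈ Icc (0:ℝ) 1 → x ≠ x₀ → DifferentiableAt ℝ u x := by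
  have h1 : ∀ n : ℕ, ∀ᵐ x, x ∈ Icc 0 (x₀ - 1/((n:ℝ)+1)) → DifferentiableAt ℝ u x := by
    intro n
    have hn : 0 < 1/((n:ℝ)+1) := by positivity
    by_cases hc : 0 ≤ x₀ - 1/((n:ℝ)+1)
    · have := ((h.1 0 _ le_rfl hc (by linarith)).aci hc).ae_differentiableAt
      rwa [uIcc_of_le hc] at this
    · exact Eventually.of_forall fun x hx => absurd (hx.1.trans hx.2) hc
  have h2 : ∀ n : ℕ, ∀ᵐ x, x ∈ Icc (x₀ + 1/((n:ℝ)+1)) 1 → DifferentiableAt ℝ u x := by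
    intro n
    have hn : 0 < 1/((n:ℝ)+1) := by positivity
    by_cases hc : x₀ + 1/((n:ℝ)+1) ≤ 1
    · have := ((h.2 _ 1 (by linarith) hc le_rfl).aci hc).ae_differentiableAt
      rwa [uIcc_of_le hc] at this
    · exact Eventually.of_forall fun x hx => absurd (hx.1.trans hx.2) hc
  filter_upwards [ae_all_iff.mpr h1, ae_all_iff.mpr h2] with x k1 k2 hx hxx
  rcases lt_or_gt_of_ne hxx with hl | hl
  · obtain ⟨n, hn⟩ := exists_nat_one_div_lt (sub_pos.mpr hl)
    exact k1 n ⟨hx.1, by linarith⟩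
  · obtain ⟨n, hn⟩ := exists_nat_one_div_lt (sub_pos.mpr hl)
    exact k2 n ⟨by linarith, hx.2⟩

lemma forward {a u : ℝ → ℝ} {x₀ K : ℝ} (hd : StronglyDeg a x₀ K)
    (hu : IntegrableOn (fun x => (u x)^2) (Ioo 0 1)) (hl : LocACAway u x₀)
    (hw : ACOn (fun x => a x * deriv u x) 0 1) :
    ACOn (fun x => a x * u x) 0 1 ∧
      IntegrableOn (fun x => (deriv (fun y => a y * u y) x)^2) (Ioo 0 1) := by
  obtain ⟨hdeg, hW, hK⟩ := hd
  have ha := hW.1.aci zero_le_one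
  have hx₀ := hdeg.1
  have haz := hdeg.2.1
  obtain ⟨M, hM, hlip, hader⟩ := lip_bound hx₀ haz hW
  obtain ⟨C, hC⟩ := (hw.aci zero_le_one).exists_bound
  rw [uIcc_of_le (zero_le_one' ℝ)] at hC
  set v : ℝ → ℝ := fun x => a x * u x with hv
  have hadiff := ha.ae_differentiableAt
  rw [uIcc_of_le (zero_le_one' ℝ)] at hadiff
  have hne : ∀ᵐ x : ℝ, x ≠ x₀ := by simp [ae_iff, measure_singleton]
  have hsq : IntegrableOn (fun x => (deriv v x)^2) (Ioo 0 1) := by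
    have hb : IntegrableOn (fun x => 2 * M^2 * (u x)^2 + 2 * C^2) (Ioo 0 1) :=
      (hu.const_mul _).add (integrableOn_const (by simp) (by finiteness))
    refine hb.mono' ((measurable_deriv v).pow_const 2).aestronglyMeasurable ?_
    refine (ae_restrict_iff' measurableSet_Ioo).mpr ?_
    filter_upwards [hne, hadiff, hader, ae_diff_away hl] with x hxx k1 k2 k3 hx
    have hx' := Ioo_subset_Icc_self hx
    have e : deriv v x = deriv a x * u x + a x * deriv u x :=
      ((k1 hx').hasDerivAt.mul (k3 hx' hxx).hasDerivAt).deriv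
    rw [Real.norm_of_nonneg (sq_nonneg _), e]
    have b1 : (deriv a x)^2 ≤ M^2 := sq_le_sq' (by linarith [neg_abs_le (deriv a x), k2 hx'])
      ((le_abs_self _).trans (k2 hx'))
    have b2 : (a x * deriv u x)^2 ≤ C^2 := by
      have := hC x hx'
      rw [Real.norm_eq_abs] at this
      exact sq_le_sq' (by linarith [neg_abs_le (a x * deriv u x)]) ((le_abs_self _).trans this)
    have b3 := mul_le_mul_of_nonneg_right b1 (sq_nonneg (u x))
    nlinarith [sq_nonneg (deriv a x * u x - a x * deriv u x)]
  have hg : IntervalIntegrable (deriv v) volume 0 1 := by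
    rw [intervalIntegrable_iff_integrableOn_Ioo_of_le zero_le_one]
    have hb : IntegrableOn (fun x => (deriv v x)^2 + 1) (Ioo 0 1) :=
      hsq.add (integrableOn_const (by simp) (by simp))
    refine hb.mono' (measurable_deriv v).aestronglyMeasurable (Eventually.of_forall fun x => ?_)
    rw [Real.norm_eq_abs, ← sq_abs]
    nlinarith [sq_nonneg (|deriv v x| - 1), abs_nonneg (deriv v x)]
  have hu' : IntervalIntegrable (fun x => (u x)^2) volume 0 1 := by
    rw [intervalIntegrable_iff_integrableOn_Ioo_of_le zero_le_one]; exact hu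
  have m0 : (0:ℝ) ∈ uIcc (0:ℝ) 1 := left_mem_uIcc
  have m1 : (1:ℝ) ∈ uIcc (0:ℝ) 1 := right_mem_uIcc
  have mx : x₀ ∈ uIcc (0:ℝ) 1 := by rw [uIcc_of_le zero_le_one]; exact ⟨hx₀.1.le, hx₀.2.le⟩
  have s0 : uIcc 0 x₀ ⊆ uIcc 0 1 := uIcc_subset_uIcc m0 mx
  have s1 : uIcc 1 x₀ ⊆ uIcc 0 1 := uIcc_subset_uIcc m1 mx
  have f0 : ∀ x ∈ uIcc 0 x₀, x ≠ x₀ → v x = v 0 + ∫ t in (0:ℝ)..x, deriv v t := by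
    intro x hx hxx
    rw [uIcc_of_le hx₀.1.le] at hx
    have hlt := lt_of_le_of_ne hx.2 hxx
    have h1 := (hl.1 0 x le_rfl hx.1 hlt).aci hx.1
    have h2 := (ha.mono (c := 0) (d := x) (by
      rw [uIcc_of_le hx.1, uIcc_of_le zero_le_one]; exact Icc_subset_Icc_right (by linarith [hx₀.2]))).fun_mul h1
    exact aci_eq h2 right_mem_uIcc
  have f1 : ∀ x ∈ uIcc 1 x₀, x ≠ x₀ → v x = v 1 + ∫ t in (1:ℝ)..x, deriv v t := by
    intro x hx hxx
    rw [uIcc_of_ge hx₀.2.le] at hx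
    have hlt := lt_of_le_of_ne hx.1 hxx.symm
    have h1 := (hl.2 x 1 hlt hx.2 le_rfl).aci hx.2
    have h2 := (ha.mono (c := x) (d := 1) (by
      rw [uIcc_of_le hx.2, uIcc_of_le zero_le_one]; exact Icc_subset_Icc_left (by linarith [hx₀.1]))).fun_mul h1
    exact aci_eq h2.symm right_mem_uIcc
  have z0 := lim_zero (a := a) (u := u) (g := deriv v) hx₀.1.ne
    (by rw [zero_sub, abs_neg, abs_of_pos hx₀.1]; exact hx₀.2.le) hM
    (fun x hx => hlip x (by have := s0 hx; rwa [uIcc_of_le zero_le_one] at this))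
    (hg.mono_set s0) (hu'.mono_set s0) f0
  have z1 := lim_zero (a := a) (u := u) (g := deriv v) hx₀.2.ne'
    (by rw [abs_of_pos (by linarith [hx₀.2])]; linarith [hx₀.1]) hM
    (fun x hx => hlip x (by have := s1 hx; rwa [uIcc_of_le zero_le_one] at this))
    (hg.mono_set s1) (hu'.mono_set s1) f1
  refine ⟨⟨hg, fun x hx => ?_⟩, hsq⟩
  change v x = v 0 + ∫ t in (0:ℝ)..x, deriv v t
  change v 0 + _ = 0 at z0
  change v 1 + _ = 0 at z1
  by_cases hxx : x = x₀
  · rw [hxx, z0]; simp [hv, haz]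
  rcases lt_or_gt_of_ne hxx with h | h
  · exact f0 x (by rw [uIcc_of_le hx₀.1.le]; exact ⟨hx.1, h.le⟩) hxx
  · rw [f1 x (by rw [uIcc_of_ge hx₀.2.le]; exact ⟨h.le, hx.2⟩) hxx]
    have mx' : x ∈ uIcc (0:ℝ) 1 := by rwa [uIcc_of_le zero_le_one]
    have i1 := intervalIntegral.integral_add_adjacent_intervals
      (hg.mono_set (uIcc_subset_uIcc m1 mx)) (hg.mono_set (uIcc_subset_uIcc mx mx'))
    have i2 := intervalIntegral.integral_add_adjacent_intervals
      (hg.mono_set (uIcc_subset_uIcc m0 mx)) (hg.mono_set (uIcc_subset_uIcc mx mx'))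
    linarith

lemma tendsto_of_acon {f : ℝ → ℝ} {x₀ : ℝ} (hx₀ : x₀ ∈ Ioo (0:ℝ) 1) (h : ACOn f 0 1)
    (h0 : f x₀ = 0) : Tendsto f (nhdsWithin x₀ (Icc (0:ℝ) 1 \ {x₀})) (nhds 0) := by
  have := (h.aci zero_le_one).continuousOn
  rw [uIcc_of_le zero_le_one] at this
  have h2 := this x₀ ⟨hx₀.1.le, hx₀.2.le⟩
  rw [ContinuousWithinAt, h0] at h2
  exact h2.mono_left (nhdsWithin_mono _ sdiff_subset)

/-- Characterization of `D(A₁)` in the strongly degenerate case. -/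
theorem statement6 (a : ℝ → ℝ) (x₀ : ℝ) (ha : ∃ K, StronglyDeg a x₀ K) :
    ∀ u : ℝ → ℝ, MemDA1 a u x₀ false ↔
      (IntegrableOn (fun x => (u x)^2) (Ioo 0 1) ∧ LocACAway u x₀ ∧
        ACOn (fun x => a x * u x) 0 1 ∧
        IntegrableOn (fun x => (deriv (fun y => a y * u y) x)^2) (Ioo 0 1) ∧
        ACOn (fun x => a x * deriv u x) 0 1 ∧
        IntegrableOn (fun x => (deriv (fun y => a y * deriv u y) x)^2) (Ioo 0 1) ∧
        Filter.Tendsto (fun x => a x * u x)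
          (nhdsWithin x₀ (Icc (0:ℝ) 1 \ {x₀})) (nhds 0) ∧
        Filter.Tendsto (fun x => a x * deriv u x)
          (nhdsWithin x₀ (Icc (0:ℝ) 1 \ {x₀})) (nhds 0) ∧
        deriv u 0 = 0 ∧ deriv u 1 = 0) := by
  obtain ⟨K, hd⟩ := ha
  have hx₀ := hd.1.1
  have haz := hd.1.2.1
  intro u
  constructor
  · rintro ⟨⟨⟨h1, h2, h3⟩, h4, h5⟩, h6, h7⟩
    obtain ⟨k1, k2⟩ := forward hd h1 h2 h4
    exact ⟨h1, h2, k1, k2, h4, h5, tendsto_of_acon hx₀ k1 (by simp [haz]),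
      tendsto_of_acon hx₀ h4 (by simp [haz]), h6, h7⟩
  · rintro ⟨h1, h2, h3, h4, h5, h6, h7, h8, h9, h10⟩
    exact ⟨⟨⟨h1, h2, backward hd h5 h6⟩, h5, h6⟩, h9, h10⟩
end
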